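/- For the Cheng-Kac Jordan superalgebra J = JCK(Z,δ), let L_J ⊆ End_F(J) denote the space of left multiplication operators L_z : c ↦ zc (z ∈ J). Then the map z ↦ L_z is injective, L_J ∩ Inder(J) = 0, so dim_F(L_J ⊕ Inder(J)) = 16·dim_F Z, and the Tits–Kantor–Koecher Lie superalgebra K(J) = CK(Z,δ), whose underlying vector space is J ⊕ J ⊕ (L_J ⊕ Inder(J)), satisfies dim_F K(J) = 4·dim_F J = 32·dim_F Z, with even and odd parts each of dimension 16·dim_F Z. -/

import Mathlib

namespace CKJ

variable (F : Type*) [Field F] {Z : Type*} [CommRing Z] [Algebra F Z]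

/-- Underlying module of the Cheng–Kac Jordan superalgebra `JCK(Z,δ)`:
the even part has `Z`-coordinates `1, w₁, w₂, w₃` (indices `0,1,2,3`) and the
odd part has `Z`-coordinates `x, x₁, x₂, x₃` (indices `0,1,2,3`). -/
abbrev J (Z : Type*) := (Fin 4 → Z) × (Fin 4 → Z)

/-- The product of two even elements, in coordinates:
`w₁² = w₂² = 1`, `w₃² = -1`, `wᵢwⱼ = 0` for `i ≠ j`. -/
def emul (a c : Fin 4 → Z) : Fin 4 → Z :=
  ![a 0 * c 0 + a 1 * c 1 + a 2 * c 2 - a 3 * c 3,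
    a 0 * c 1 + a 1 * c 0,
    a 0 * c 2 + a 2 * c 0,
    a 0 * c 3 + a 3 * c 0]

/-- The product of two odd elements: `(fx)(gx) = δ(f)g - fδ(g)`,
`(fxᵢ)(gx) = (fg)wᵢ`, `(fx)(gxⱼ) = -(fg)wⱼ`, `(fxᵢ)(gxⱼ) = 0`. -/
def omul (δ : Z → Z) (b d : Fin 4 → Z) : Fin 4 → Z :=
  ![δ (b 0) * d 0 - b 0 * δ (d 0),
    b 1 * d 0 - b 0 * d 1,
    b 2 * d 0 - b 0 * d 2,
    b 3 * d 0 - b 0 * d 3]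

/-- The product of an even element by an odd element: `f(gx) = (fg)x`,
`f(gxⱼ) = (fg)xⱼ`, `(fwᵢ)(gx) = (δ(f)g)xᵢ`, `(fwᵢ)(gxⱼ) = -(fg)x_{i×j}`. -/
def eomul (δ : Z → Z) (a d : Fin 4 → Z) : Fin 4 → Z :=
  ![a 0 * d 0,
    a 0 * d 1 + δ (a 1) * d 0 + (a 2 * d 3 - a 3 * d 2),
    a 0 * d 2 + δ (a 2) * d 0 + (a 3 * d 1 - a 1 * d 3),
    a 0 * d 3 + δ (a 3) * d 0 + (a 2 * d 1 - a 1 * d 2)]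

/-- The (supercommutative) multiplication of the Cheng–Kac Jordan
superalgebra `JCK(Z,δ)`. -/
def jmul (δ : Z → Z) (u v : J Z) : J Z :=
  (emul u.1 v.1 + omul δ u.2 v.2, eomul δ u.1 v.2 + eomul δ v.1 u.2)

/-- `fw f k` is the even element `f·wₖ` (with the convention `w₀ = 1`). -/
def fw (f : Z) (k : Fin 4) : J Z := (fun j => if j = k then f else 0, 0)

/-- `fone f` is the even element `f·1`. -/
def fone (f : Z) : J Z := fw f 0

/-- `fxi f k` is the odd element `f·xₖ` (with the convention `x₀ = x`). -/
def fxi (f : Z) (k : Fin 4) : J Z := (0, fun j => if j = k then f else 0)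

/-- `fx f` is the odd element `f·x`. -/
def fx (f : Z) : J Z := fxi f 0

/-- The grading involution of the superalgebra `J` (identity on the even part,
minus the identity on the odd part). -/
def jsig (u : J Z) : J Z := (u.1, -u.2)

/-- `F`-linearity of a map `J → J`. -/
def IsLin (d : J Z → J Z) : Prop :=
  (∀ u v, d (u + v) = d u + d v) ∧ ∀ (c : F) (u), d (c • u) = c • d u

/-- `d` is an even derivation of the superalgebra `J = JCK(Z,δ)`. -/
def IsDer0 (δ : Z → Z) (d : J Z → J Z) : Prop :=
  IsLin F d ∧ (∀ u : J Z, u.2 = 0 → (d u).2 = 0) ∧ (∀ u : J Z, u.1 = 0 → (d u).1 = 0) ∧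
    ∀ u v, d (jmul δ u v) = jmul δ (d u) v + jmul δ u (d v)

/-- `d` is an odd derivation of the superalgebra `J = JCK(Z,δ)`. -/
def IsDer1 (δ : Z → Z) (d : J Z → J Z) : Prop :=
  IsLin F d ∧ (∀ u : J Z, u.2 = 0 → (d u).1 = 0) ∧ (∀ u : J Z, u.1 = 0 → (d u).2 = 0) ∧
    ∀ u v, d (jmul δ u v) = jmul δ (d u) v + jmul δ (jsig u) (d v)

/-- The set `Der(J) = Der(J)₀ ⊕ Der(J)₁` of all derivations of `J`. -/
def DerJSet (δ : Z → Z) : Set (J Z → J Z) :=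
  {d | ∃ d0 d1, IsDer0 F δ d0 ∧ IsDer1 F δ d1 ∧ d = d0 + d1}

/-- `u` is homogeneous of parity `p` (`p = true` means odd). -/
def IsHom (p : Bool) (u : J Z) : Prop := if p then u.1 = 0 else u.2 = 0

/-- `(-1)^{pq}` -/
def sgn (p q : Bool) : ℤ := if p && q then -1 else 1

/-- `Dgen δ ε u v` is the inner derivation `D(u,v) : c ↦ u(vc) - ε·v(uc)`;
for homogeneous `u`, `v` one takes `ε = (-1)^{|u||v|}`. -/
def Dgen (δ : Z → Z) (ε : ℤ) (u v : J Z) : J Z → J Z :=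
  fun c => jmul δ u (jmul δ v c) - ε • jmul δ v (jmul δ u c)

/-- Generators `D(u,v)`, `u`, `v` homogeneous, of `Inder(J)`. -/
def InderSet (δ : Z → Z) : Set (J Z → J Z) :=
  {d | ∃ u v p q, IsHom p u ∧ IsHom q v ∧ d = Dgen δ (sgn p q) u v}

/-- Generators of the even part `Inder(J)₀`. -/
def InderSet0 (δ : Z → Z) : Set (J Z → J Z) :=
  {d | ∃ u v p, IsHom p u ∧ IsHom p v ∧ d = Dgen δ (sgn p p) u v}

/-- Generators of the odd part `Inder(J)₁`. -/
def InderSet1 (δ : Z → Z) : Set (J Z → J Z) :=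
  {d | ∃ u v p, IsHom p u ∧ IsHom (!p) v ∧ d = Dgen δ 1 u v}

/-- Coordinate index of each sector of the `ℤ₂×ℤ₂`-grading:
`[0,0] ↦ 0`, `[1,0] ↦ 1`, `[0,1] ↦ 2`, `[1,1] ↦ 3`. -/
def idx (t : ZMod 2 × ZMod 2) : Fin 4 :=
  if t = (0, 0) then 0 else if t = (1, 0) then 1 else if t = (0, 1) then 2 else 3

/-- The sector `J^{[t]}` of the `ℤ₂×ℤ₂`-grading of `J`:
`J^{[0,0]} = Z ⊕ Zx`, `J^{[1,0]} = Zw₁ ⊕ Zx₁`, `J^{[0,1]} = Zw₂ ⊕ Zx₂`,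
`J^{[1,1]} = Zw₃ ⊕ Zx₃`. -/
def gset (t : ZMod 2 × ZMod 2) : Set (J Z) :=
  {u | ∀ k : Fin 4, k ≠ idx t → u.1 k = 0 ∧ u.2 k = 0}

/-- `d : J → J` has degree `t` with respect to the `ℤ₂×ℤ₂`-grading of `J`. -/
def DerDeg (t : ZMod 2 × ZMod 2) (d : J Z → J Z) : Prop :=
  ∀ s u, u ∈ gset s → d u ∈ gset (s + t)

/-! The Kantor double superalgebra of vector type `K = Z ⊕ Zx`, realised
as `Z × Z`: the pair `(f, g)` represents `f + gx`. -/

/-- The multiplication of `K = Z ⊕ Zx`. -/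
def kmul (δ : Z → Z) (u v : Z × Z) : Z × Z :=
  (u.1 * v.1 + (δ u.2 * v.2 - u.2 * δ v.2), u.1 * v.2 + v.1 * u.2)

/-- The grading involution of `K`. -/
def ksig (u : Z × Z) : Z × Z := (u.1, -u.2)

/-- `F`-linearity of a map `K → K`. -/
def IsKLin (d : Z × Z → Z × Z) : Prop :=
  (∀ u v, d (u + v) = d u + d v) ∧ ∀ (c : F) (u), d (c • u) = c • d u

/-- `d` is an even derivation of `K = Z ⊕ Zx`. -/
def IsKDer0 (δ : Z → Z) (d : Z × Z → Z × Z) : Prop :=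
  IsKLin F d ∧ (∀ u : Z × Z, u.2 = 0 → (d u).2 = 0) ∧ (∀ u : Z × Z, u.1 = 0 → (d u).1 = 0) ∧
    ∀ u v, d (kmul δ u v) = kmul δ (d u) v + kmul δ u (d v)

/-- `d` is an odd derivation of `K = Z ⊕ Zx`. -/
def IsKDer1 (δ : Z → Z) (d : Z × Z → Z × Z) : Prop :=
  IsKLin F d ∧ (∀ u : Z × Z, u.2 = 0 → (d u).1 = 0) ∧ (∀ u : Z × Z, u.1 = 0 → (d u).2 = 0) ∧
    ∀ u v, d (kmul δ u v) = kmul δ (d u) v + kmul δ (ksig u) (d v)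

/-- `Dk δ ε u v` is the inner derivation `D(u,v) : c ↦ u(vc) - ε·v(uc)` of `K`. -/
def Dk (δ : Z → Z) (ε : ℤ) (u v : Z × Z) : Z × Z → Z × Z :=
  fun c => kmul δ u (kmul δ v c) - ε • kmul δ v (kmul δ u c)

/-- `u ∈ K` is homogeneous of parity `p`. -/
def KHom (p : Bool) (u : Z × Z) : Prop := if p then u.1 = 0 else u.2 = 0

/-- Generators `D(u,v)`, `u`, `v` homogeneous, of `Inder(K)`. -/
def InderKSet (δ : Z → Z) : Set (Z × Z → Z × Z) :=
  {d | ∃ u v p q, KHom p u ∧ KHom q v ∧ d = Dk δ (sgn p q) u v}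

/-- Generators of the even part `Inder(K)₀`. -/
def InderKSet0 (δ : Z → Z) : Set (Z × Z → Z × Z) :=
  {d | ∃ u v p, KHom p u ∧ KHom p v ∧ d = Dk δ (sgn p p) u v}

/-- Generators of the odd part `Inder(K)₁`. -/
def InderKSet1 (δ : Z → Z) : Set (Z × Z → Z × Z) :=
  {d | ∃ u v p, KHom p u ∧ KHom (!p) v ∧ d = Dk δ 1 u v}

/-- The odd derivation `η_a` of `K`: `η_a(f) = 0`, `η_a(fx) = fa`. -/
def keta (a : Z) : Z × Z → Z × Z := fun u => (a * u.2, 0)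

/-- `kcheck μ a` is the even map `μ̌` of `K` with `μ̌(f) = μ(f)` and
`μ̌(gx) = (μ(g) + ag)x`. -/
def kcheck (μ : Z → Z) (a : Z) : Z × Z → Z × Z := fun u => (μ u.1, μ u.2 + a * u.2)

/-- The odd map `(aδ)⁻` of `K` (relevant in characteristic 3):
`(aδ)⁻(f) = (aδ(f))x`, `(aδ)⁻(fx) = δ(aδ(f))`. -/
def kminus (δ : Z → Z) (a : Z) : Z × Z → Z × Z := fun u => (δ (a * δ u.2), a * δ u.1)

/-- `D̄er(K) = Der(K)₀ ⊕ {η_a : a ∈ Z}`. -/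
def DerbarK (δ : Z → Z) : Set (Z × Z → Z × Z) :=
  {e | ∃ e0 a, IsKDer0 F δ e0 ∧ e = e0 + keta a}

/-- The extension `∂̃` to `J` of the even derivation `∂ = μ̌ = kcheck μ a`
of `K`: `∂̃|_K = ∂`, `∂̃(fwᵢ) = μ(f)wᵢ`, `∂̃(fxᵢ) = (μ(f) - af)xᵢ`. -/
def jtilde (μ : Z → Z) (a : Z) : J Z → J Z :=
  fun u => (fun k => μ (u.1 k),
    fun k => if k = 0 then μ (u.2 0) + a * u.2 0 else μ (u.2 k) - a * u.2 k)

/-- The odd derivation `η̃_a` of `J`: `η̃_a(Z) = 0`, `η̃_a(x) = a`,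
`η̃_a(xⱼ) = 0` (hence `η̃_a(fwᵢ) = -(af)xᵢ`). -/
def jeta (a : Z) : J Z → J Z :=
  fun u => (fun k => if k = 0 then a * u.2 0 else 0,
            fun k => if k = 0 then 0 else -(a * u.1 k))

/-- The even component of an endomorphism of `J`. -/
def evp (X : J Z → J Z) : J Z → J Z := fun u => (2 : F)⁻¹ • (X u + jsig (X (jsig u)))

/-- The odd component of an endomorphism of `J`. -/
def odp (X : J Z → J Z) : J Z → J Z := fun u => (2 : F)⁻¹ • (X u - jsig (X (jsig u)))

/-- The supercommutator `[X,Y]` in `End_F(J)`. -/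
def sbr (X Y : J Z → J Z) : J Z → J Z :=
  X ∘ Y - Y ∘ X + (2 : F) • (odp F Y ∘ odp F X)

/-- The odd component of an endomorphism of `K`. -/
def kodp (e : Z × Z → Z × Z) : Z × Z → Z × Z :=
  fun u => (2 : F)⁻¹ • (e u - ksig (e (ksig u)))

/-- The supercommutator `[e,e']` in `End_F(K)`. -/
def ksbr (e e' : Z × Z → Z × Z) : Z × Z → Z × Z :=
  e ∘ e' - e' ∘ e + (2 : F) • (kodp F e' ∘ kodp F e)

/-- The automorphism `τ₁ = (12)(34)`: identity on `J^{[0,0]} ⊕ J^{[1,1]}`,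
`-1` on `J^{[1,0]} ⊕ J^{[0,1]}`. -/
def tau1Map : J Z → J Z :=
  fun u => (![u.1 0, -u.1 1, -u.1 2, u.1 3], ![u.2 0, -u.2 1, -u.2 2, u.2 3])

/-- The automorphism `τ₂ = (23)(41)`: identity on `J^{[0,0]} ⊕ J^{[1,0]}`,
`-1` on `J^{[0,1]} ⊕ J^{[1,1]}`. -/
def tau2Map : J Z → J Z :=
  fun u => (![u.1 0, u.1 1, -u.1 2, -u.1 3], ![u.2 0, u.2 1, -u.2 2, -u.2 3])

/-- The automorphism `φ = (123)`: the `Z`-linear map with `φ(vⱼ) = vⱼ₊₁`,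
`φ(yⱼ) = yⱼ₊₁` (indices mod 3), `φ(1) = 1`, `φ(y) = y`, where `v₁ = i·w₁`,
`v₂ = i·w₂`, `v₃ = w₃`, `y = x`, `y₁ = i·x₁`, `y₂ = i·x₂`, `y₃ = x₃`.
In the `w`/`x` coordinates: `w₁ ↦ w₂ ↦ -i·w₃`, `w₃ ↦ i·w₁`,
`x₁ ↦ x₂ ↦ -i·x₃`, `x₃ ↦ i·x₁`. -/
def phiMap (i : F) : J Z → J Z :=
  fun u => (![u.1 0, algebraMap F Z i * u.1 3, u.1 1, -(algebraMap F Z i * u.1 2)],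
            ![u.2 0, algebraMap F Z i * u.2 3, u.2 1, -(algebraMap F Z i * u.2 2)])

/-- The automorphism `τ = (12)`: `Z`-linear with `τ(1) = 1`, `τ(y) = y`,
`τ(v₁) = -v₂`, `τ(v₂) = -v₁`, `τ(v₃) = -v₃`, `τ(y₁) = -y₂`, `τ(y₂) = -y₁`,
`τ(y₃) = -y₃`. -/
def tauMap : J Z → J Z :=
  fun u => (![u.1 0, -u.1 2, -u.1 1, -u.1 3], ![u.2 0, -u.2 2, -u.2 1, -u.2 3])

/-- `g` is an `F`-algebra automorphism of `J = JCK(Z,δ)`. -/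
def IsJAut (δ : Z → Z) (g : J Z → J Z) : Prop :=
  IsLin F g ∧ Function.Bijective g ∧ ∀ u v, g (jmul δ u v) = jmul δ (g u) (g v)

/-- The coordinatization map `Φ : K → Der(J)^{[1,1]}`,
`Φ(f + gy) = D(v₁, f·v₂) + i·D(v₃, g·y)`. -/
def Phi (δ : Z → Z) (i : F) (p : Z × Z) : J Z → J Z :=
  Dgen δ 1 (fw (algebraMap F Z i) 1) (fw (p.1 * algebraMap F Z i) 2) +
    i • Dgen δ 1 (fw (1 : Z) 3) (fx p.2)

/-- `ι₁(z) = φ ∘ Φ(z) ∘ φ⁻¹`, `ι₂(z) = φ² ∘ Φ(z) ∘ φ⁻²`, `ι₃(z) = Φ(z)`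
(indexed here by `j = 0, 1, 2` respectively; note `φ⁻¹ = φ²`). -/
def iot (δ : Z → Z) (i : F) (j : Fin 3) (z : Z × Z) : J Z → J Z :=
  if j = 0 then phiMap F i ∘ Phi F δ i z ∘ (phiMap F i ∘ phiMap F i)
  else if j = 1 then (phiMap F i ∘ phiMap F i) ∘ Phi F δ i z ∘ phiMap F i
  else Phi F δ i z

/-- The embedding `K = Z ⊕ Zx ⊆ J`. -/
def kap : Z × Z → J Z :=
  fun p => (fun j => if j = 0 then p.1 else 0, fun j => if j = 0 then p.2 else 0)

/-- The projection `J → K` onto the `Z ⊕ Zx` coordinates. -/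
def pik : J Z → Z × Z := fun u => (u.1 0, u.2 0)

end CKJ

open CKJ

namespace CKJ

variable {F : Type*} [Field F] {Z : Type*} [CommRing Z] [Algebra F Z]

/-- Left multiplication `z ↦ L_z` as a linear map. -/
def leftMul (δ : Derivation F Z Z) : J Z →ₗ[F] (J Z → J Z) where
  toFun z := jmul δ z
  map_add' u v := by
    funext c
    ext k <;> fin_cases k <;> simp [jmul, emul, omul, eomul] <;> ring
  map_smul' r u := by
    funext c
    ext k <;> fin_cases k <;> simp [jmul, emul, omul, eomul, Algebra.smul_def] <;> ring

/-- The inner derivation with even coordinates `a` and odd coordinates `b`: it is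
`D(a, x)` for `a` regarded as an odd element, plus `D(∑ᵢ bᵢwᵢ, x) + D(w₁, b₀x₁)`. -/
def innerFun (δ : Z → Z) (a b : Fin 4 → Z) (u : J Z) : J Z :=
  (![-(2 * a 0 * δ (u.1 0)) + b 0 * u.2 0 - b 1 * u.2 1 - b 2 * u.2 2 + b 3 * u.2 3,
     -(2 * a 0 * δ (u.1 1)) + (u.1 3 * a 2 - u.1 2 * a 3)
       + (δ (b 1) * u.2 0 - b 1 * δ (u.2 0)) + (b 2 * u.2 3 - b 3 * u.2 2),
     -(2 * a 0 * δ (u.1 2)) + (u.1 1 * a 3 - u.1 3 * a 1)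
       + (δ (b 2) * u.2 0 - b 2 * δ (u.2 0)) + (b 3 * u.2 1 - b 1 * u.2 3),
     -(2 * a 0 * δ (u.1 3)) + (u.1 1 * a 2 - u.1 2 * a 1)
       + (δ (b 3) * u.2 0 - b 3 * δ (u.2 0)) + (b 2 * u.2 1 - b 1 * u.2 2)],
   ![δ (a 0) * u.2 0 - 2 * a 0 * δ (u.2 0) - b 1 * u.1 1 - b 2 * u.1 2 + b 3 * u.1 3,
     -(δ (a 0) * u.2 1 + 2 * a 0 * δ (u.2 1)) + δ (a 1) * u.2 0
       + (u.2 3 * a 2 - u.2 2 * a 3) - b 0 * u.1 1 - b 1 * δ (u.1 0)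
       + (b 2 * δ (u.1 3) - b 3 * δ (u.1 2)),
     -(δ (a 0) * u.2 2 + 2 * a 0 * δ (u.2 2)) + δ (a 2) * u.2 0
       + (u.2 1 * a 3 - u.2 3 * a 1) - b 0 * u.1 2 - b 2 * δ (u.1 0)
       + (b 3 * δ (u.1 1) - b 1 * δ (u.1 3)),
     -(δ (a 0) * u.2 3 + 2 * a 0 * δ (u.2 3)) + δ (a 3) * u.2 0
       + (u.2 1 * a 2 - u.2 2 * a 1) - b 0 * u.1 3 - b 3 * δ (u.1 0)
       + (b 2 * δ (u.1 1) - b 1 * δ (u.1 2))])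

/-- The coordinatization of `Inder(J)` by `J` as a linear map. -/
def innerMap (δ : Derivation F Z Z) : J Z →ₗ[F] (J Z → J Z) where
  toFun z := innerFun δ z.1 z.2
  map_add' u v := by
    funext c
    ext k <;> fin_cases k <;> simp [innerFun] <;> ring
  map_smul' r u := by
    funext c
    ext k <;> fin_cases k <;> simp [innerFun, Algebra.smul_def] <;> ring

lemma leftMul_apply (δ : Derivation F Z Z) (z : J Z) : leftMul δ z = jmul δ z := rfl

lemma innerMap_apply (δ : Derivation F Z Z) (a b : Fin 4 → Z) :
    innerMap δ (a, b) = innerFun δ a b := rfl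

lemma jmul_one (δ : Derivation F Z Z) (z : J Z) : jmul δ z (fone 1) = z := by
  ext k <;> fin_cases k <;> simp [jmul, emul, omul, eomul, fone, fw]

lemma innerMap_one (δ : Derivation F Z Z) (z : J Z) : innerMap δ z (fone 1) = 0 := by
  ext k <;> fin_cases k <;> simp [innerMap, innerFun, fone, fw]

lemma leftMul_injective (δ : Derivation F Z Z) : Function.Injective (leftMul δ) := by
  intro u v h
  simpa [leftMul_apply, jmul_one] using congrFun h (fone 1)

lemma disjoint_range_leftMul_innerMap (δ : Derivation F Z Z) :
    Disjoint (LinearMap.range (leftMul δ)) (LinearMap.range (innerMap δ)) := by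
  rw [Submodule.disjoint_def]
  rintro _ ⟨u, rfl⟩ ⟨d, hd⟩
  have h := congrFun hd (fone 1)
  rw [innerMap_one, leftMul_apply, jmul_one] at h
  rw [← h, map_zero]

lemma eq_zero_of_mul_derivation_eq_zero {δ : Derivation F Z Z}
    (hspan : Submodule.span F {z : Z | ∃ f g : Z, z = f * δ g} = ⊤) {a : Z}
    (ha : ∀ h, a * δ h = 0) : a = 0 := by
  have hle : Submodule.span F {z : Z | ∃ f g : Z, z = f * δ g} ≤
      LinearMap.ker (LinearMap.mulLeft F a) := by
    rw [Submodule.span_le]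
    rintro _ ⟨f, g, rfl⟩
    simp [mul_left_comm a f, ha]
  have h1 : (1 : Z) ∈ LinearMap.ker (LinearMap.mulLeft F a) := hle (hspan ▸ Submodule.mem_top)
  simpa using h1

lemma innerMap_injective (h2 : (2 : F) ≠ 0) {δ : Derivation F Z Z}
    (hspan : Submodule.span F {z : Z | ∃ f g : Z, z = f * δ g} = ⊤) :
    Function.Injective (innerMap δ) := by
  rw [injective_iff_map_eq_zero]
  rintro ⟨a, b⟩ h
  have hw1 := congrFun h (fw 1 1)
  have hw2 := congrFun h (fw 1 2)
  have hw3 := congrFun h (fw 1 3)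
  have hx := congrFun (congrArg Prod.fst (congrFun h (fx 1))) 0
  have a0 : a 0 = 0 := eq_zero_of_mul_derivation_eq_zero hspan fun g => by
    have hg := congrFun (congrArg Prod.fst (congrFun h (fone g))) 0
    have hg' : (2 : F) • (a 0 * δ g) = 0 := by
      rw [ofNat_smul_eq_nsmul, nsmul_eq_mul]
      simpa [innerMap, innerFun, fone, fw, mul_assoc] using hg
    exact (smul_eq_zero_iff_right h2).mp hg'
  simp [innerMap_apply, innerFun, fw, Prod.ext_iff] at hw1 hw2 hw3
  simp [innerMap_apply, innerFun, fx, fxi] at hx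
  ext k <;> fin_cases k <;> simp_all

lemma Dgen_even_even (δ : Derivation F Z Z) (a c : Fin 4 → Z) :
    Dgen δ 1 (a, 0) (c, 0) = innerMap δ
      (![0, a 2 * c 3 - a 3 * c 2, a 3 * c 1 - a 1 * c 3, a 2 * c 1 - a 1 * c 2], 0) := by
  funext u
  ext k <;> fin_cases k <;>
    simp [Dgen, jmul, emul, omul, eomul, innerMap_apply, innerFun] <;> ring

lemma Dgen_odd_odd (δ : Derivation F Z Z) (b d : Fin 4 → Z) :
    Dgen δ (-1) (0, b) (0, d) = innerMap δ
      (![b 0 * d 0, b 0 * d 1 + b 1 * d 0, b 0 * d 2 + b 2 * d 0, b 0 * d 3 + b 3 * d 0], 0) := by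
  funext u
  ext k <;> fin_cases k <;>
    simp [Dgen, jmul, emul, omul, eomul, innerMap_apply, innerFun] <;> ring

lemma Dgen_even_odd (δ : Derivation F Z Z) (a d : Fin 4 → Z) :
    Dgen δ 1 (a, 0) (0, d) = innerMap δ
      (0, ![δ (a 0) * d 0 + a 1 * d 1 + a 2 * d 2 - a 3 * d 3,
        a 1 * d 0, a 2 * d 0, a 3 * d 0]) := by
  funext u
  ext k <;> fin_cases k <;>
    simp [Dgen, jmul, emul, omul, eomul, innerMap_apply, innerFun] <;> ring

lemma Dgen_one_swap (δ : Z → Z) (u v : J Z) : Dgen δ 1 u v = -Dgen δ 1 v u := by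
  funext c
  simp [Dgen]

lemma span_InderSet0 (δ : Derivation F Z Z) :
    Submodule.span F (InderSet0 δ) =
      LinearMap.range (innerMap δ ∘ₗ LinearMap.inl F (Fin 4 → Z) (Fin 4 → Z)) := by
  apply le_antisymm
  · rw [Submodule.span_le]
    rintro _ ⟨⟨a, b⟩, ⟨c, d⟩, p, hu, hv, rfl⟩
    cases p
    · obtain rfl : b = 0 := by simpa [IsHom] using hu
      obtain rfl : d = 0 := by simpa [IsHom] using hv
      exact ⟨_, (Dgen_even_even δ a c).symm⟩
    · obtain rfl : a = 0 := by simpa [IsHom] using hu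
      obtain rfl : c = 0 := by simpa [IsHom] using hv
      exact ⟨_, (Dgen_odd_odd δ b d).symm⟩
  · rintro _ ⟨a, rfl⟩
    refine Submodule.subset_span ⟨(0, a), (0, ![1, 0, 0, 0]), true, rfl, rfl, ?_⟩
    refine Eq.trans ?_ (Dgen_odd_odd δ a ![1, 0, 0, 0]).symm
    refine congrArg (innerMap δ) ?_
    ext k <;> fin_cases k <;> simp

lemma span_InderSet1 (δ : Derivation F Z Z) :
    Submodule.span F (InderSet1 δ) =
      LinearMap.range (innerMap δ ∘ₗ LinearMap.inr F (Fin 4 → Z) (Fin 4 → Z)) := by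
  apply le_antisymm
  · rw [Submodule.span_le]
    rintro _ ⟨⟨a, b⟩, ⟨c, d⟩, p, hu, hv, rfl⟩
    cases p
    · obtain rfl : b = 0 := by simpa [IsHom] using hu
      obtain rfl : c = 0 := by simpa [IsHom] using hv
      exact ⟨_, (Dgen_even_odd δ a d).symm⟩
    · obtain rfl : a = 0 := by simpa [IsHom] using hu
      obtain rfl : d = 0 := by simpa [IsHom] using hv
      rw [Dgen_one_swap]
      exact neg_mem ⟨_, (Dgen_even_odd δ c b).symm⟩
  · rintro _ ⟨b, rfl⟩
    have hb : (innerMap δ ∘ₗ LinearMap.inr F (Fin 4 → Z) (Fin 4 → Z)) b =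
        Dgen δ 1 (b, 0) (0, ![1, 0, 0, 0])
          + Dgen δ 1 (![0, 1, 0, 0], 0) (0, ![0, b 0 - δ (b 0), 0, 0]) := by
      rw [Dgen_even_odd, Dgen_even_odd, ← map_add]
      refine congrArg (innerMap δ) ?_
      ext k <;> fin_cases k <;> simp
    rw [hb]
    have hgen (a d : Fin 4 → Z) :
        Dgen δ 1 (a, 0) (0, d) ∈ Submodule.span F (InderSet1 δ) :=
      Submodule.subset_span ⟨(a, 0), (0, d), false, rfl, rfl, rfl⟩
    exact add_mem (hgen _ _) (hgen _ _)

lemma InderSet_eq_union (δ : Derivation F Z Z) :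
    Submodule.span F (InderSet δ) =
      Submodule.span F (InderSet0 δ) ⊔ Submodule.span F (InderSet1 δ) := by
  rw [← Submodule.span_union]
  congr 1
  ext d
  constructor
  · rintro ⟨u, v, p, q, hu, hv, rfl⟩
    cases p <;> cases q
    · exact Or.inl ⟨u, v, false, hu, hv, rfl⟩
    · exact Or.inr ⟨u, v, false, hu, hv, rfl⟩
    · exact Or.inr ⟨u, v, true, hu, hv, rfl⟩
    · exact Or.inl ⟨u, v, true, hu, hv, rfl⟩
  · rintro (⟨u, v, p, hu, hv, rfl⟩ | ⟨u, v, p, hu, hv, rfl⟩)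
    · exact ⟨u, v, p, p, hu, hv, rfl⟩
    · exact ⟨u, v, p, !p, hu, hv, by cases p <;> rfl⟩

lemma span_InderSet (δ : Derivation F Z Z) :
    Submodule.span F (InderSet δ) = LinearMap.range (innerMap δ) := by
  rw [InderSet_eq_union, span_InderSet0, span_InderSet1, LinearMap.range_comp,
    LinearMap.range_comp, ← Submodule.map_sup, LinearMap.sup_range_inl_inr,
    LinearMap.range_eq_map]

lemma span_eq_range {M V : Type*} [AddCommGroup M] [Module F M] [AddCommGroup V] [Module F V]
    (f : M →ₗ[F] V) : Submodule.span F {L : V | ∃ z, L = f z} = LinearMap.range f := by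
  rw [← Submodule.span_eq (LinearMap.range f)]
  congr 1
  ext L
  simp [eq_comm]

section Rank

universe v

variable {M V : Type v} [AddCommGroup M] [Module F M] [AddCommGroup V] [Module F V]

lemma rank_range_sup_range {f g : M →ₗ[F] V} (hf : Function.Injective f)
    (hg : Function.Injective g) (h : Disjoint (LinearMap.range f) (LinearMap.range g)) :
    Module.rank F ↥(LinearMap.range f ⊔ LinearMap.range g) = 2 * Module.rank F M := by
  rw [← add_zero (Module.rank F _), ← rank_bot F V, ← h.eq_bot,
    Submodule.rank_sup_add_rank_inf_eq, rank_range_of_injective f hf,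
    rank_range_of_injective g hg, two_mul]

lemma rank_prod_prod (M V : Type v) [AddCommGroup M] [Module F M] [AddCommGroup V] [Module F V] :
    Module.rank F (M × M × V) = 2 * Module.rank F M + Module.rank F V := by
  rw [rank_prod', rank_prod', ← add_assoc, two_mul]

lemma rank_prod_prod_range_sup_range {f g : M →ₗ[F] V} (hf : Function.Injective f)
    (hg : Function.Injective g) (h : Disjoint (LinearMap.range f) (LinearMap.range g)) :
    Module.rank F (M × M × ↥(LinearMap.range f ⊔ LinearMap.range g)) = 4 * Module.rank F M := by
  rw [rank_prod_prod, rank_range_sup_range hf hg h, ← add_mul]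
  norm_num

end Rank

variable (F Z) in
lemma rank_fin_four_fun : Module.rank F (Fin 4 → Z) = 4 * Module.rank F Z := by
  simp

variable (F Z) in
lemma rank_J : Module.rank F (J Z) = 8 * Module.rank F Z := by
  rw [rank_prod', rank_fin_four_fun, ← add_mul]
  norm_num

end CKJ

theorem stmt14 {F : Type*} [Field F] (h2 : (2 : F) ≠ 0) {Z : Type*} [CommRing Z] [Algebra F Z]
    (δ : Derivation F Z Z)
    (hspan : Submodule.span F {z : Z | ∃ f g : Z, z = f * δ g} = ⊤) :
    -- `z ↦ L_z` is injective
    Function.Injective (fun z : J Z => jmul (⇑δ) z) ∧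
    -- `L_J ∩ Inder(J) = 0`
    (Submodule.span F {L : J Z → J Z | ∃ z : J Z, L = jmul (⇑δ) z}
        ⊓ Submodule.span F (InderSet (⇑δ)) = ⊥) ∧
    -- `dim_F (L_J ⊕ Inder(J)) = 16 · dim_F Z`
    Module.rank F ↥(Submodule.span F {L : J Z → J Z | ∃ z : J Z, L = jmul (⇑δ) z}
        ⊔ Submodule.span F (InderSet (⇑δ))) = 16 * Module.rank F Z ∧
    -- `dim_F K(J) = 4 · dim_F J = 32 · dim_F Z`, K(J) = J ⊕ J ⊕ (L_J ⊕ Inder(J))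
    Module.rank F (J Z × J Z ×
        ↥(Submodule.span F {L : J Z → J Z | ∃ z : J Z, L = jmul (⇑δ) z}
          ⊔ Submodule.span F (InderSet (⇑δ)))) = 32 * Module.rank F Z ∧
    Module.rank F (J Z × J Z ×
        ↥(Submodule.span F {L : J Z → J Z | ∃ z : J Z, L = jmul (⇑δ) z}
          ⊔ Submodule.span F (InderSet (⇑δ)))) = 4 * Module.rank F (J Z) ∧
    -- the even part K(J)₀ = J₀ ⊕ J₀ ⊕ (L_{J₀} ⊕ Inder(J)₀) has dimension 16·dim_F Z
    Module.rank F ((Fin 4 → Z) × (Fin 4 → Z) ×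
        ↥(Submodule.span F {L : J Z → J Z | ∃ a : Fin 4 → Z,
              L = jmul (⇑δ) ((a, 0) : J Z)}
          ⊔ Submodule.span F (InderSet0 (⇑δ)))) = 16 * Module.rank F Z ∧
    -- the odd part K(J)₁ = J₁ ⊕ J₁ ⊕ (L_{J₁} ⊕ Inder(J)₁) has dimension 16·dim_F Z
    Module.rank F ((Fin 4 → Z) × (Fin 4 → Z) ×
        ↥(Submodule.span F {L : J Z → J Z | ∃ b : Fin 4 → Z,
              L = jmul (⇑δ) ((0, b) : J Z)}
          ⊔ Submodule.span F (InderSet1 (⇑δ)))) = 16 * Module.rank F Z := by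
  have hL := leftMul_injective δ
  have hD := innerMap_injective h2 hspan
  have hdisj := disjoint_range_leftMul_innerMap δ
  have hspanL : Submodule.span F {L : J Z → J Z | ∃ z : J Z, L = jmul (⇑δ) z} =
      LinearMap.range (leftMul δ) := span_eq_range (leftMul δ)
  have hspanL0 : Submodule.span F {L : J Z → J Z | ∃ a : Fin 4 → Z,
      L = jmul (⇑δ) ((a, 0) : J Z)} = LinearMap.range (leftMul δ ∘ₗ LinearMap.inl F _ _) :=
    span_eq_range (leftMul δ ∘ₗ LinearMap.inl F _ _)
  have hspanL1 : Submodule.span F {L : J Z → J Z | ∃ b : Fin 4 → Z,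
      L = jmul (⇑δ) ((0, b) : J Z)} = LinearMap.range (leftMul δ ∘ₗ LinearMap.inr F _ _) :=
    span_eq_range (leftMul δ ∘ₗ LinearMap.inr F _ _)
  have hrank := rank_prod_prod_range_sup_range hL hD hdisj
  have hrank0 := rank_prod_prod_range_sup_range
    (f := leftMul δ ∘ₗ LinearMap.inl F _ _) (g := innerMap δ ∘ₗ LinearMap.inl F _ _)
    (hL.comp LinearMap.inl_injective) (hD.comp LinearMap.inl_injective)
    (hdisj.mono (LinearMap.range_comp_le_range _ _) (LinearMap.range_comp_le_range _ _))
  have hrank1 := rank_prod_prod_range_sup_range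
    (f := leftMul δ ∘ₗ LinearMap.inr F _ _) (g := innerMap δ ∘ₗ LinearMap.inr F _ _)
    (hL.comp LinearMap.inr_injective) (hD.comp LinearMap.inr_injective)
    (hdisj.mono (LinearMap.range_comp_le_range _ _) (LinearMap.range_comp_le_range _ _))
  rw [hspanL, hspanL0, hspanL1, span_InderSet, span_InderSet0, span_InderSet1]
  refine ⟨hL, hdisj.eq_bot, ?_, hrank.trans ?_, hrank, hrank0.trans ?_, hrank1.trans ?_⟩
  · rw [rank_range_sup_range hL hD hdisj, rank_J, ← mul_assoc]
    norm_num
  · rw [rank_J, ← mul_assoc]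
    norm_num
  · rw [rank_fin_four_fun, ← mul_assoc]
    norm_num
  · rw [rank_fin_four_fun, ← mul_assoc]
    norm_num
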